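/- arXiv:2009.08226 — 2 statements merged into one kernel-verified Lean document; each statement's English description precedes it below -/
import Mathlib

section
/- For every prime p ≥ 5, there exists a finite p-group G together with a normal abelian subgroup N of G such that o(G) < o(N)^{1/2}. -/
/-- The average order of the elements of a group `G`:
`o(G) = (∑_{g ∈ G} |g|) / |G|`, as a real number. -/
noncomputable def avgOrder (G : Type*) [Group G] : ℝ :=
  (∑ᶠ g : G, (orderOf g : ℝ)) / (Nat.card G)

open Finset

theorem avgOrder_eq_of_mulEquiv {G H : Type*} [Group G] [Group H] (e : G ≃* H) :
    avgOrder G = avgOrder H := by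
  unfold avgOrder
  rw [Nat.card_congr e.toEquiv]
  congr 1
  exact finsum_eq_of_bijective e e.bijective fun x => by simp [MulEquiv.orderOf_eq]

/-- An upper bound for `o(G)` when all elements satisfying `P` have order at most `a` and the rest,
which make up at most the `1 / c` part of `G`, have order at most `b`. -/
theorem avgOrder_le_add_div {G : Type*} [Group G] [Finite G] (P : G → Prop) {a b c : ℕ}
    (hc : 0 < c) (ha : ∀ g, P g → orderOf g ≤ a) (hb : ∀ g, ¬ P g → orderOf g ≤ b)
    (hcard : Nat.card {g // ¬ P g} * c ≤ Nat.card G) : avgOrder G ≤ a + b / c := by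
  classical
  have := Fintype.ofFinite G
  have hG : (0 : ℝ) < Nat.card G := by exact_mod_cast Nat.card_pos
  rw [avgOrder, finsum_eq_sum_of_fintype, div_le_iff₀ hG]
  calc ∑ g : G, (orderOf g : ℝ) ≤ ∑ g : G, ((a : ℝ) + if ¬ P g then (b : ℝ) else 0) := by
        refine sum_le_sum fun g _ => ?_
        by_cases h : P g
        · simpa [h] using ha g h
        · have : (orderOf g : ℝ) ≤ b := by exact_mod_cast hb g h
          simp only [h, not_false_eq_true, if_true]
          linarith [Nat.cast_nonneg (α := ℝ) a]
    _ = Nat.card G * a + Nat.card {g // ¬ P g} * b := by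
        rw [sum_add_distrib, ← sum_filter, sum_const, sum_const, nsmul_eq_mul, nsmul_eq_mul,
          Nat.card_eq_fintype_card, Nat.card_eq_fintype_card, Fintype.card_subtype, card_univ]
    _ ≤ (a + b / c) * Nat.card G := by
        have h : (Nat.card {g // ¬ P g} : ℝ) ≤ Nat.card G / c := by
          rw [le_div_iff₀ (by exact_mod_cast hc)]
          exact_mod_cast hcard
        calc _ ≤ Nat.card G * (a : ℝ) + Nat.card G / c * b := by gcongr
          _ = _ := by ring

/-- In an abelian `p`-group of exponent `p ^ (k + 1)`, at least half of the elements have order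
`p ^ (k + 1)`. -/
theorem pow_div_two_le_avgOrder {V : Type*} [CommGroup V] [Finite V] {p k : ℕ} (hp : p.Prime)
    (hV : ∀ v : V, v ^ p ^ (k + 1) = 1) (hv : ∃ v : V, v ^ p ^ k ≠ 1) :
    (p : ℝ) ^ (k + 1) / 2 ≤ avgOrder V := by
  classical
  have := Fact.mk hp
  have := Fintype.ofFinite V
  have hG : (0 : ℝ) < Nat.card V := by exact_mod_cast Nat.card_pos
  let K : Subgroup V := (powMonoidHom (p ^ k)).ker
  have hmem (v : V) : v ∈ K ↔ v ^ p ^ k = 1 := Iff.rfl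
  have hK : 2 * Nat.card K ≤ Nat.card V := by
    obtain ⟨v, hv⟩ := hv
    have h1 : K.index ≠ 1 := fun h => by
      rw [Subgroup.index_eq_one] at h
      exact hv ((hmem v).1 (h ▸ Subgroup.mem_top v))
    have h0 : K.index ≠ 0 := Subgroup.FiniteIndex.index_ne_zero
    rw [← K.card_mul_index, mul_comm]
    exact Nat.mul_le_mul_left _ (by omega)
  rw [avgOrder, finsum_eq_sum_of_fintype, le_div_iff₀ hG]
  calc (p : ℝ) ^ (k + 1) / 2 * Nat.card V ≤ (Nat.card V - Nat.card K) * (p : ℝ) ^ (k + 1) := by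
        have : (2 : ℝ) * Nat.card K ≤ Nat.card V := by exact_mod_cast hK
        have hp0 : (0 : ℝ) ≤ (p : ℝ) ^ (k + 1) := by positivity
        nlinarith
    _ = ∑ v : V, ((p : ℝ) ^ (k + 1) - if v ∈ K then (p : ℝ) ^ (k + 1) else 0) := by
        rw [sum_sub_distrib, ← sum_filter, sum_const, sum_const, nsmul_eq_mul, nsmul_eq_mul,
          Nat.card_eq_fintype_card, Nat.card_eq_fintype_card, Fintype.card_subtype, card_univ]
        ring
    _ ≤ ∑ v : V, (orderOf v : ℝ) := by
        refine sum_le_sum fun v _ => ?_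
        by_cases h : v ∈ K
        · simp [h]
        · rw [orderOf_eq_prime_pow (fun h' => h ((hmem v).2 h')) (hV v)]
          simp [h]

theorem SemidirectProduct.mk_pow {V P : Type*} [CommGroup V] [Group P] (φ : P →* MulAut V)
    (x : V ⋊[φ] P) (n : ℕ) :
    x ^ n = ⟨∏ t ∈ range n, φ (x.right ^ t) x.left, x.right ^ n⟩ := by
  induction n with
  | zero => ext <;> simp
  | succ n ih => rw [pow_succ, ih, prod_range_succ, pow_succ]; rfl

/-- The semidirect product `V ⋊ P` is a suitable group when `V` has exponent `p ^ 5`, almost all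
`g : P` satisfy `g ^ p ≠ 1`, and for these the norm of `g ^ p` kills `V`, so that all elements of
`V ⋊ P` above `g` have order at most `p ^ 2`. -/
theorem exists_pGroup_avgOrder_lt_sqrt_of_action {V P : Type} [CommGroup V] [Group P]
    [Finite V] [Finite P] {p : ℕ} (hp : p.Prime) (hp5 : 5 ≤ p) (φ : P →* MulAut V)
    (hV : ∀ v : V, v ^ p ^ 5 = 1) (hv : ∃ v : V, v ^ p ^ 4 ≠ 1)
    (hP : ∀ g : P, g ^ p ^ 2 = 1)
    (hnorm : ∀ g : P, g ^ p ≠ 1 → ∀ v, ∏ t ∈ range p, φ ((g ^ p) ^ t) v = 1)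
    (hcard : Nat.card {g : P // g ^ p = 1} * p ^ 5 ≤ Nat.card P) :
    ∃ (G : Type) (_ : Group G) (_ : Finite G), IsPGroup p G ∧
      ∃ N : Subgroup G, N.Normal ∧ (∀ x ∈ N, ∀ y ∈ N, x * y = y * x) ∧
        avgOrder G < avgOrder N ^ ((1 : ℝ) / 2) := by
  classical
  have hfin : Finite (V ⋊[φ] P) := Finite.of_equiv _ SemidirectProduct.equivProd.symm
  have hone (x : V ⋊[φ] P) {m : ℕ} (hx : x.right ^ m = 1) : x ^ (m * p ^ 5) = 1 := by
    have h : x ^ m = SemidirectProduct.inl (x ^ m).left := by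
      ext
      · rfl
      · rw [SemidirectProduct.mk_pow]
        exact hx
    rw [pow_mul, h, ← map_pow, hV, map_one]
  refine ⟨V ⋊[φ] P, inferInstance, hfin, fun x => ⟨7, ?_⟩, SemidirectProduct.inl.range, ?_, ?_, ?_⟩
  · rw [show p ^ 7 = p ^ 2 * p ^ 5 by ring]
    exact hone x (hP _)
  · rw [SemidirectProduct.range_inl_eq_ker_rightHom]
    infer_instance
  · rintro _ ⟨x, rfl⟩ _ ⟨y, rfl⟩
    rw [← map_mul, mul_comm, map_mul]
  have hp0 := hp.pos
  have hG : avgOrder (V ⋊[φ] P) ≤ (p ^ 2 : ℕ) + (p ^ 6 : ℕ) / (p ^ 5 : ℕ) := by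
    refine avgOrder_le_add_div (fun x => x.right ^ p ≠ 1) (by positivity) (fun x hx => ?_)
      (fun x hx => ?_) ?_
    · refine orderOf_le_of_pow_eq_one (by positivity) ?_
      have hr : (x ^ p).right = x.right ^ p := by rw [SemidirectProduct.mk_pow]
      rw [pow_two, pow_mul, SemidirectProduct.mk_pow]
      ext
      · simpa [hr] using hnorm x.right hx _
      · simp [hr, ← pow_mul, ← pow_two, hP]
    · refine orderOf_le_of_pow_eq_one (by positivity) ?_
      rw [show p ^ 6 = p * p ^ 5 by ring]
      exact hone x (not_not.1 hx)
    · have e : {x : V ⋊[φ] P // ¬ x.right ^ p ≠ 1} ≃ V × {g : P // g ^ p = 1} :=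
        { toFun x := (x.1.left, ⟨x.1.right, not_not.1 x.2⟩)
          invFun y := ⟨⟨y.1, y.2.1⟩, not_not.2 y.2.2⟩
          left_inv _ := rfl
          right_inv _ := rfl }
      rw [Nat.card_congr e, Nat.card_prod, SemidirectProduct.card, mul_assoc]
      exact Nat.mul_le_mul_left _ hcard
  have hN : (p : ℝ) ^ 5 / 2 ≤ avgOrder (SemidirectProduct.inl (φ := φ)).range := by
    rw [← avgOrder_eq_of_mulEquiv
      (MonoidHom.ofInjective (SemidirectProduct.inl_injective (φ := φ)))]
    exact pow_div_two_le_avgOrder hp hV hv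
  have hp' : (5 : ℝ) ≤ p := by exact_mod_cast hp5
  have hG' : avgOrder (V ⋊[φ] P) ≤ (p : ℝ) ^ 2 + p := by
    refine hG.trans_eq ?_
    push_cast
    field_simp
  rw [← Real.sqrt_eq_rpow]
  refine hG'.trans_lt (Real.lt_sqrt_of_sq_lt (lt_of_lt_of_le ?_ hN))
  have h1 : 2 * ((p : ℝ) + 1) ^ 2 < (p : ℝ) ^ 3 := by nlinarith [sq_nonneg ((p : ℝ) - 5)]
  have h2 : (0 : ℝ) < (p : ℝ) ^ 2 := by positivity
  nlinarith

theorem ZMod.sum_range_mul {p : ℕ} [Fact p.Prime] {M : Type*} [AddCommMonoid M] (F : ZMod p → M)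
    {c : ZMod p} (hc : c ≠ 0) : ∑ t ∈ range p, F (t * c) = ∑ a, F a := by
  refine sum_nbij' (fun t => (t : ZMod p) * c) (fun a => (a * c⁻¹).val) ?_ ?_ ?_ ?_ ?_
  · simp
  · simp [ZMod.val_lt]
  · intro t ht
    simp [hc, ZMod.val_natCast, Nat.mod_eq_of_lt (mem_range.1 ht)]
  · simp [hc]
  · simp

section NormZero

variable {P : Type*} [Group P] {p : ℕ} [NeZero p]

/-- The functions `P → ZMod n` that sum to zero over every coset of the image of `ζ`. -/
def normZero (n : ℕ) (ζ : Multiplicative (ZMod p) →* P) : AddSubgroup (P → ZMod n) where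
  carrier := {f | ∀ x, ∑ c : ZMod p, f (x * ζ (.ofAdd c)) = 0}
  zero_mem' := by simp
  add_mem' hf hg x := by simp [sum_add_distrib, hf x, hg x]
  neg_mem' hf x := by simp [hf x]

/-- The action of `P` on `normZero n ζ` by right translation of the argument. -/
def normZeroAction (n : ℕ) (ζ : Multiplicative (ZMod p) →* P) (hζ : ∀ c g, Commute (ζ c) g) :
    P →* MulAut (Multiplicative (normZero n ζ)) :=
  let T (g : P) : normZero n ζ →+ normZero n ζ :=
    { toFun f := ⟨fun x => f.1 (x * g), fun x => by
        simpa [mul_assoc, (hζ _ g).eq] using f.2 (x * g)⟩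
      map_zero' := rfl
      map_add' _ _ := rfl }
  { toFun g :=
      { toFun f := .ofAdd (T g f.toAdd)
        invFun f := .ofAdd (T g⁻¹ f.toAdd)
        left_inv f := by
          apply Multiplicative.toAdd.injective
          ext x
          simp [T]
        right_inv f := by
          apply Multiplicative.toAdd.injective
          ext x
          simp [T]
        map_mul' _ _ := rfl }
    map_one' := by
      ext f x
      simp [T]
    map_mul' g h := by
      ext f x
      simp [T, mul_assoc] }

theorem normZeroAction_apply (n : ℕ) (ζ : Multiplicative (ZMod p) →* P)
    (hζ : ∀ c g, Commute (ζ c) g) (g : P) (f : Multiplicative (normZero n ζ)) (x : P) :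
    (normZeroAction n ζ hζ g f).toAdd.1 x = f.toAdd.1 (x * g) := rfl

theorem prod_normZeroAction_eq_one [Fact p.Prime] (n : ℕ) (ζ : Multiplicative (ZMod p) →* P)
    (hζ : ∀ c g, Commute (ζ c) g) {c : ZMod p} (hc : c ≠ 0) (f : Multiplicative (normZero n ζ)) :
    ∏ t ∈ range p, normZeroAction n ζ hζ (ζ (.ofAdd c) ^ t) f = 1 := by
  apply Multiplicative.toAdd.injective
  ext x
  rw [toAdd_prod, AddSubgroup.val_finsetSum, Finset.sum_apply]
  simp_rw [normZeroAction_apply, ← map_pow, ← ofAdd_nsmul, nsmul_eq_mul]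
  rw [ZMod.sum_range_mul (fun c => f.toAdd.1 (x * ζ (.ofAdd c))) hc]
  exact f.toAdd.2 x

theorem exists_normZero_apply_one (n : ℕ) (ζ : Multiplicative (ZMod p) →* P)
    (hζ : ∃ c, ζ c ≠ 1) : ∃ f ∈ normZero n ζ, f 1 = 1 := by
  classical
  obtain ⟨c, hc⟩ := hζ
  let h : P → ZMod n := Pi.single 1 1
  refine ⟨fun x => h x - h (x * ζ c), fun x => ?_, by simp [h, hc]⟩
  rw [sum_sub_distrib, sub_eq_zero]
  refine Fintype.sum_equiv (Equiv.subRight c.toAdd) _ _ fun a => ?_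
  rw [mul_assoc, ← map_mul]
  congr 3
  apply Multiplicative.toAdd.injective
  simp

end NormZero

section IsShifted

variable {R : Type*} [CommRing R] {n : ℕ}

/-- `X` vanishes below its `k`-th superdiagonal, whose entries are given by `c`. -/
def IsShifted (k : ℕ) (c : ℕ → R) (X : Matrix (Fin n) (Fin n) R) : Prop :=
  ∀ i j : Fin n, ((j : ℕ) < i + k → X i j = 0) ∧ ((j : ℕ) = i + k → X i j = c i)

variable {k l : ℕ} {c d : ℕ → R} {X Y : Matrix (Fin n) (Fin n) R}

theorem isShifted_one : IsShifted 0 1 (1 : Matrix (Fin n) (Fin n) R) := fun i j =>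
  ⟨fun h => Matrix.one_apply_ne fun e => by simp [e] at h,
    fun h => by rw [Fin.ext h, Matrix.one_apply_eq, Pi.one_apply]⟩

theorem IsShifted.add (hX : IsShifted k c X) (hY : IsShifted k d Y) :
    IsShifted k (c + d) (X + Y) := fun i j =>
  ⟨fun h => by simp [(hX i j).1 h, (hY i j).1 h], fun h => by simp [(hX i j).2 h, (hY i j).2 h]⟩

theorem IsShifted.of_lt (hX : IsShifted l c X) (h : k < l) : IsShifted k 0 X := fun i j =>
  ⟨fun h' => (hX i j).1 (by omega), fun h' => (hX i j).1 (by omega)⟩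

theorem IsShifted.eq_zero (hX : IsShifted k c X) (h : n ≤ k) : X = 0 := by
  ext i j
  exact (hX i j).1 (by omega)

theorem IsShifted.mul (hX : IsShifted k c X) (hY : IsShifted l d Y) :
    IsShifted (k + l) (fun i => c i * d (i + k)) (X * Y) := by
  refine fun i j => ⟨fun h => ?_, fun h => ?_⟩
  · rw [Matrix.mul_apply]
    refine sum_eq_zero fun m _ => ?_
    rcases lt_or_ge (m : ℕ) (i + k) with hm | hm
    · simp [(hX i m).1 hm]
    · simp [(hY m j).1 (by omega)]
  · have hlt : (i : ℕ) + k < n := by omega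
    rw [Matrix.mul_apply, sum_eq_single ⟨i + k, hlt⟩ (fun m _ hm => ?_) (by simp)]
    · simp only [(hX i ⟨i + k, hlt⟩).2 rfl, (hY ⟨i + k, hlt⟩ j).2 (by simp only; omega)]
    · rcases lt_or_ge (m : ℕ) (i + k) with hm' | hm'
      · simp [(hX i m).1 hm']
      · have : (m : ℕ) ≠ i + k := fun e => hm (Fin.ext e)
        simp [(hY m j).1 (by omega)]

theorem IsShifted.pow (hX : IsShifted 1 c X) (m : ℕ) :
    IsShifted m (fun i => ∏ t ∈ range m, c (i + t)) (X ^ m) := by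
  induction m with
  | zero =>
    simp only [range_zero, prod_empty, pow_zero]
    exact isShifted_one
  | succ m ih =>
    simp only [prod_range_succ, pow_succ]
    exact ih.mul hX

theorem isShifted_single (a : R) :
    IsShifted n (fun _ => a) (Matrix.single (0 : Fin (n + 1)) (Fin.last n) a) := by
  refine fun i j => ⟨fun h => ?_, fun h => ?_⟩
  · refine Matrix.single_apply_of_ne _ _ _ _ _ fun e => ?_
    simp [← e.1, ← e.2] at h
  · obtain ⟨rfl, rfl⟩ : i = 0 ∧ j = Fin.last n :=
      ⟨Fin.ext (by rw [Fin.val_zero]; omega), Fin.ext (by rw [Fin.val_last]; omega)⟩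
    simp

theorem IsShifted.eq_single {X : Matrix (Fin (n + 1)) (Fin (n + 1)) R} (hX : IsShifted n c X) :
    X = Matrix.single 0 (Fin.last n) (c 0) := by
  ext i j
  by_cases h : (j : ℕ) = i + n
  · obtain ⟨rfl, rfl⟩ : i = 0 ∧ j = Fin.last n :=
      ⟨Fin.ext (by rw [Fin.val_zero]; omega), Fin.ext (by rw [Fin.val_last]; omega)⟩
    simp [(hX _ _).2 h]
  · rw [(hX i j).1 (by omega), ((isShifted_single (c 0)) i j).1 (by omega)]

theorem IsShifted.mul_sub_one {p n : ℕ} [Fact p.Prime] {F : Type*} [CommRing F] [CharP F p]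
    {M N : Matrix (Fin n) (Fin n) F} {a b : F} (ha : IsShifted 1 (fun i => a ^ p ^ i) (M - 1))
    (hb : IsShifted 1 (fun i => b ^ p ^ i) (N - 1)) :
    IsShifted 1 (fun i => (a + b) ^ p ^ i) (M * N - 1) := by
  have h : M * N - 1 = (M - 1) + (N - 1) + (M - 1) * (N - 1) := by noncomm_ring
  have h' := (ha.add hb).add ((ha.mul hb).of_lt one_lt_two)
  rw [h]
  convert h' using 2 with i
  simp [add_pow_char_pow]

end IsShifted

section TwistedUnitriangular

variable (p : ℕ) [Fact p.Prime]

/-- The unitriangular matrices of size `p + 1` over the field with `p ^ p` elements whose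
superdiagonal has the form `a, a ^ p, a ^ p ^ 2, …`. -/
def twistedUnitriangular : Submonoid (Matrix (Fin (p + 1)) (Fin (p + 1)) (GaloisField p p)) where
  carrier := {M | ∃ a, IsShifted 1 (fun i => a ^ p ^ i) (M - 1)}
  one_mem' := by
    refine ⟨0, fun i j => ?_⟩
    simp [(Fact.out : p.Prime).ne_zero]
  mul_mem' := by
    rintro M N ⟨a, ha⟩ ⟨b, hb⟩
    exact ⟨a + b, ha.mul_sub_one hb⟩

variable {p}

namespace twistedUnitriangular

theorem pow_eq {M : Matrix (Fin (p + 1)) (Fin (p + 1)) (GaloisField p p)}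
    {a : GaloisField p p} (h : IsShifted 1 (fun i => a ^ p ^ i) (M - 1)) :
    M ^ p = 1 + Matrix.single 0 (Fin.last p)
      (algebraMap (ZMod p) (GaloisField p p) (Algebra.norm (ZMod p) a)) := by
  have hM : M = 1 + (M - 1) := by abel
  rw [hM, add_pow_char_of_commute p (Commute.one_left _), one_pow, (h.pow p).eq_single,
    FiniteField.algebraMap_norm_eq_prod_pow]
  simp [GaloisField.finrank p (Fact.out : p.Prime).ne_zero]

/-- The matrices with a single entry from the prime field, in the corner, added to `1`. -/
noncomputable def corner :
    Multiplicative (ZMod p) →* twistedUnitriangular p where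
  toFun c := ⟨1 + Matrix.single 0 (Fin.last p) (algebraMap _ _ c.toAdd), 0, by
    rw [add_sub_cancel_left]
    convert (isShifted_single _).of_lt (Fact.out : p.Prime).one_lt
    simp [(Fact.out : p.Prime).ne_zero]⟩
  map_one' := by
    ext1
    simp
  map_mul' c d := by
    ext1
    have h : (Fin.last p) ≠ 0 := by simp [Fin.ext_iff, (Fact.out : p.Prime).ne_zero]
    simp [mul_add, add_mul, Matrix.single_add, h, add_assoc]

theorem corner_injective : Function.Injective (corner (p := p)) := by
  intro c d h
  have h1 := congrArg Subtype.val h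
  simp only [corner, MonoidHom.coe_mk, OneHom.coe_mk, add_right_inj] at h1
  have h' := congrFun₂ h1 0 (Fin.last p)
  simpa using h'

theorem commute_corner (c : Multiplicative (ZMod p))
    (M : twistedUnitriangular p) : Commute (corner c) M := by
  obtain ⟨M, a, h⟩ := M
  apply Subtype.ext
  let S := Matrix.single (0 : Fin (p + 1)) (Fin.last p)
    (algebraMap (ZMod p) (GaloisField p p) c.toAdd)
  change (1 + S) * M = M * (1 + S)
  have h1 : S * (M - 1) = 0 := ((isShifted_single _).mul h).eq_zero le_rfl
  have h2 : (M - 1) * S = 0 := (h.mul (isShifted_single _)).eq_zero (by omega)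
  rw [mul_sub, mul_one, sub_eq_zero] at h1
  rw [sub_mul, one_mul, sub_eq_zero] at h2
  rw [add_mul, mul_add, h1, h2, one_mul, mul_one]

theorem exists_pow_eq_corner (M : twistedUnitriangular p) :
    ∃ c, M ^ p = corner c := by
  obtain ⟨M, a, h⟩ := M
  exact ⟨.ofAdd (Algebra.norm (ZMod p) a), Subtype.ext (pow_eq h)⟩

theorem pow_sq_eq_one (M : twistedUnitriangular p) : M ^ p ^ 2 = 1 := by
  obtain ⟨c, hc⟩ := exists_pow_eq_corner M
  rw [pow_two, pow_mul, hc, ← map_pow]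
  convert map_one corner
  apply Multiplicative.toAdd.injective
  simp

noncomputable instance : Group (twistedUnitriangular p) where
  inv M := M ^ (p ^ 2 - 1)
  inv_mul_cancel M := by
    rw [← pow_succ, Nat.sub_add_cancel (Nat.one_le_pow _ _ (Fact.out : p.Prime).pos)]
    exact pow_sq_eq_one M

theorem sub_one_apply_zero_one {M : Matrix (Fin (p + 1)) (Fin (p + 1)) (GaloisField p p)}
    {a : GaloisField p p} (h : IsShifted 1 (fun i => a ^ p ^ i) (M - 1)) : (M - 1) 0 1 = a := by
  have h1 : ((1 : Fin (p + 1)) : ℕ) = 1 := by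
    rw [Fin.val_one', Nat.mod_eq_of_lt]
    have := (Fact.out : p.Prime).pos
    omega
  simpa using (h 0 1).2 (by rw [h1, Fin.val_zero])

/-- The superdiagonal parameter `a`, as a homomorphism. -/
noncomputable def param : twistedUnitriangular p →* Multiplicative (GaloisField p p) where
  toFun M := .ofAdd ((M.1 - 1) 0 1)
  map_one' := by simp
  map_mul' := by
    rintro ⟨M, a, ha⟩ ⟨N, b, hb⟩
    rw [sub_one_apply_zero_one ha, sub_one_apply_zero_one hb, ← ofAdd_add]
    exact congrArg _ (sub_one_apply_zero_one (ha.mul_sub_one hb))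

theorem param_surjective : Function.Surjective (param (p := p)) := by
  intro a
  let X : Matrix (Fin (p + 1)) (Fin (p + 1)) (GaloisField p p) :=
    .of fun i j => if (j : ℕ) = i + 1 then a.toAdd ^ p ^ (i : ℕ) else 0
  have h : IsShifted 1 (fun i => a.toAdd ^ p ^ i) (1 + X - 1) := by
    rw [add_sub_cancel_left]
    exact fun i j => ⟨fun h => by simp [X, h.ne], fun h => by simp [X, h]⟩
  exact ⟨⟨1 + X, a.toAdd, h⟩, Multiplicative.toAdd.injective (sub_one_apply_zero_one h)⟩

theorem param_eq_one_of_pow_eq_one {M : twistedUnitriangular p} (hM : M ^ p = 1) :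
    param M = 1 := by
  obtain ⟨M, a, h⟩ := M
  have h1 := congrArg Subtype.val hM
  change M ^ p = 1 at h1
  rw [pow_eq h, add_eq_left] at h1
  have h2 := congrFun₂ h1 0 (Fin.last p)
  rw [Matrix.single_apply_same, Matrix.zero_apply, map_eq_zero, Algebra.norm_eq_zero_iff] at h2
  exact Multiplicative.toAdd.injective ((sub_one_apply_zero_one h).trans h2)

theorem card_pow_eq_one_mul_le :
    Nat.card {M : twistedUnitriangular p // M ^ p = 1} * p ^ p ≤
      Nat.card (twistedUnitriangular p) := by
  have hidx : (param (p := p)).ker.index = p ^ p := by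
    rw [Subgroup.index_ker, MonoidHom.range_eq_top.2 param_surjective, Subgroup.card_top]
    exact GaloisField.card p p (Fact.out : p.Prime).ne_zero
  rw [← (param (p := p)).ker.card_mul_index, hidx]
  refine Nat.mul_le_mul_right _ (Nat.card_le_card_of_injective
    (fun M => ⟨M.1, param_eq_one_of_pow_eq_one M.2⟩) fun M N h => ?_)
  exact Subtype.ext (congrArg (fun x => x.1) h)

end twistedUnitriangular

end TwistedUnitriangular

/-- For every prime `p ≥ 5` there exists a finite `p`-group `G` with a normal
abelian subgroup `N` such that `o(G) < o(N)^(1/2)`. -/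
theorem exists_pGroup_avgOrder_lt_sqrt (p : ℕ) (hp : p.Prime) (hp5 : 5 ≤ p) :
    ∃ (G : Type) (_ : Group G) (_ : Finite G), IsPGroup p G ∧
      ∃ N : Subgroup G, N.Normal ∧ (∀ x ∈ N, ∀ y ∈ N, x * y = y * x) ∧
        avgOrder G < avgOrder N ^ ((1 : ℝ) / 2) := by
  have := Fact.mk hp
  have hζ := twistedUnitriangular.commute_corner (p := p)
  refine exists_pGroup_avgOrder_lt_sqrt_of_action hp hp5
    (normZeroAction (p ^ 5) twistedUnitriangular.corner hζ) (fun f => ?_) ?_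
    twistedUnitriangular.pow_sq_eq_one (fun g hg f => ?_)
    ((Nat.mul_le_mul_left _ (Nat.pow_le_pow_right hp.pos hp5)).trans
      twistedUnitriangular.card_pow_eq_one_mul_le)
  · apply Multiplicative.toAdd.injective
    ext x
    simp only [toAdd_pow, AddSubgroup.coe_nsmul, Pi.smul_apply, nsmul_eq_mul, CharP.cast_eq_zero,
      zero_mul]
    rfl
  · obtain ⟨f, hf, hf1⟩ := exists_normZero_apply_one (p ^ 5) (twistedUnitriangular.corner (p := p))
      ⟨.ofAdd 1, by simp [map_ne_one_iff _ twistedUnitriangular.corner_injective]⟩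
    refine ⟨.ofAdd ⟨f, hf⟩, fun h => ?_⟩
    have h1 : p ^ 4 • f 1 = 0 := congrFun (congrArg (fun v => v.toAdd.1) h) 1
    rw [hf1, nsmul_one, ZMod.natCast_eq_zero_iff, Nat.pow_dvd_pow_iff_le_right hp.one_lt] at h1
    omega
  · obtain ⟨c, hc⟩ := twistedUnitriangular.exists_pow_eq_corner g
    rw [hc] at hg ⊢
    exact prod_normZeroAction_eq_one _ _ hζ (c := c.toAdd) (fun h => hg (by
      rw [show c = 1 from Multiplicative.toAdd.injective h, map_one])) f
end

section
/- For every real number c₂ > 0 there exist a finite group G and a normal subgroup N of G such that o(G) < c₂ · o(N)^{1/2}. (In particular, there is no constant c₂ > 0 with o(G) ≥ c₂ · o(N)^{1/2} for all finite groups G and all normal subgroups N of G.) -/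
open Filter Finset in
/-- The ratios `(∑ d ∣ n, d φ(d)) / n²` get arbitrarily small. -/
theorem exists_sum_divisors_mul_totient_lt (ε : ℝ) (hε : 0 < ε) :
    ∃ n : ℕ, 0 < n ∧ ((∑ d ∈ n.divisors, d * d.totient : ℕ) : ℝ) < ε * (n : ℝ) ^ 2 := by
  have hdiv := (not_summable_iff_tendsto_nat_atTop_of_nonneg
    (fun n ↦ Set.indicator_nonneg (fun _ _ ↦ by positivity) n)).1 not_summable_one_div_on_primes
  have hlim : Tendsto (fun x : ℝ ↦ Real.exp (-(x / 2))) atTop (nhds 0) :=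
    Real.tendsto_exp_neg_atTop_nhds_zero.comp (tendsto_id.atTop_div_const (by norm_num))
  obtain ⟨N, hN⟩ := (((hlim.comp hdiv).comp (tendsto_add_atTop_nat 1)).eventually_lt_const
    hε).exists
  refine ⟨primorial N, primorial_pos N, ?_⟩
  let f : ArithmeticFunction ℕ := ⟨fun d ↦ d * d.totient, by simp⟩
  have hf : f.IsMultiplicative := by
    refine ⟨by simp [f], fun {m n} h ↦ ?_⟩
    simp only [f, ArithmeticFunction.coe_mk, Nat.totient_mul h]
    ring
  have hsum : ∑ d ∈ (primorial N).divisors, d * d.totient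
      = ∏ p ∈ N.primesLE, (1 + p * p.totient) := by
    have := hf.prodPrimeFactors_one_add_of_squarefree (squarefree_primorial N)
    rw [primeFactors_primorial] at this
    exact this.symm
  have hexp : Real.exp (-((∑ i ∈ range (N + 1),
      Set.indicator {p | p.Prime} (fun n : ℕ ↦ (1 : ℝ) / n) i) / 2))
      = ∏ p ∈ N.primesLE, Real.exp (-(1 / (p : ℝ) / 2)) := by
    rw [← Real.exp_sum, sum_neg_distrib, ← sum_div, Nat.primesLE_eq_filter_range, sum_filter]
    simp [Set.indicator_apply]
  have hpos : (0 : ℝ) < (primorial N : ℝ) ^ 2 := by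
    have := primorial_pos N
    positivity
  simp only [Function.comp_apply] at hN
  rw [hexp] at hN
  refine lt_of_le_of_lt ?_ (mul_lt_mul_of_pos_right hN hpos)
  rw [hsum, primorial_eq_prod_primesLE]
  push_cast
  rw [← prod_pow, ← prod_mul_distrib]
  refine prod_le_prod (fun p _ ↦ by positivity) fun p hp ↦ ?_
  have hpp := Nat.prime_of_mem_primesLE hp
  have h2 : (2 : ℝ) ≤ p := by exact_mod_cast hpp.two_le
  rw [Nat.totient_prime hpp, Nat.cast_sub hpp.one_le]
  have h1 : 1 - 1 / (p : ℝ) / 2 ≤ Real.exp (-(1 / (p : ℝ) / 2)) := by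
    linarith [Real.add_one_le_exp (-(1 / (p : ℝ) / 2))]
  refine le_trans ?_ (mul_le_mul_of_nonneg_right h1 (by positivity))
  have h3 : (1 - 1 / (p : ℝ) / 2) * (p : ℝ) ^ 2 = (p : ℝ) ^ 2 - p / 2 := by
    field_simp
  rw [h3]
  push_cast
  nlinarith

theorem IsCyclic.sum_orderOf (H : Type*) [Group H] [Fintype H] [IsCyclic H] :
    ∑ h : H, orderOf h = ∑ d ∈ (Fintype.card H).divisors, d * d.totient := by
  classical
  rw [← Finset.sum_fiberwise_of_maps_to (s := Finset.univ) (t := (Fintype.card H).divisors)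
    (g := orderOf) (fun h _ ↦ by simp [orderOf_dvd_card])]
  refine Finset.sum_congr rfl fun d hd ↦ ?_
  rw [Finset.sum_congr rfl (g := fun _ ↦ d) (by simp), Finset.sum_const,
    IsCyclic.card_orderOf_eq_totient (Nat.dvd_of_mem_divisors hd), smul_eq_mul, mul_comm]

/-- The multiplication action of a subgroup of the units of a field on its additive group. -/
def Subgroup.mulAutOfUnits {K : Type*} [Field K] (H : Subgroup Kˣ) :
    H →* MulAut (Multiplicative K) where
  toFun u := AddEquiv.toMultiplicative (DistribMulAction.toAddEquiv K (u : Kˣ))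
  map_one' := by ext; simp
  map_mul' a b := by
    ext x
    exact congrArg Multiplicative.ofAdd (mul_smul (a : Kˣ) (b : Kˣ) x.toAdd)

theorem Subgroup.mulAutOfUnits_apply {K : Type*} [Field K] (H : Subgroup Kˣ) (h : H)
    (x : Multiplicative K) :
    H.mulAutOfUnits h x = Multiplicative.ofAdd (((h : Kˣ) : K) * x.toAdd) := rfl

/-- In `K ⋊ H` with `H ≤ Kˣ`, an element outside `K` is conjugate to its component in `H`. -/
theorem orderOf_eq_orderOf_right {K : Type*} [Field K] (H : Subgroup Kˣ)
    (g : Multiplicative K ⋊[H.mulAutOfUnits] H) (hg : g.right ≠ 1) :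
    orderOf g = orderOf g.right := by
  have hne : 1 - ((g.right : Kˣ) : K) ≠ 0 := by
    intro h
    apply hg
    ext
    simpa using (sub_eq_zero.1 h).symm
  let y : Multiplicative K := Multiplicative.ofAdd (g.left.toAdd / (1 - ((g.right : Kˣ) : K)))
  have hconj : SemiconjBy (SemidirectProduct.inl y : Multiplicative K ⋊[H.mulAutOfUnits] H)
      (SemidirectProduct.inr g.right) g := by
    refine SemidirectProduct.ext ?_ (by simp)
    apply Multiplicative.toAdd.injective
    simp only [SemidirectProduct.mul_left, SemidirectProduct.left_inl, SemidirectProduct.right_inl,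
      SemidirectProduct.left_inr, map_one, mul_one, Subgroup.mulAutOfUnits_apply, toAdd_mul,
      toAdd_ofAdd, y]
    field_simp
    ring
  have h1 : SemidirectProduct.inl y * SemidirectProduct.inr g.right * (SemidirectProduct.inl y)⁻¹
      = g := by
    rw [hconj.eq, mul_inv_cancel_right]
  rw [← orderOf_injective SemidirectProduct.inr
    (SemidirectProduct.inr_injective (φ := H.mulAutOfUnits)) g.right]
  conv_lhs => rw [← h1]
  exact (MulAut.conj (SemidirectProduct.inl y :
    Multiplicative K ⋊[H.mulAutOfUnits] H)).orderOf_eq (SemidirectProduct.inr g.right)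

theorem avgOrder_congr {G G' : Type*} [Group G] [Group G'] (e : G ≃* G') :
    avgOrder G = avgOrder G' := by
  unfold avgOrder
  rw [Nat.card_congr e.toEquiv]
  congr 1
  exact finsum_eq_of_bijective e e.bijective fun g ↦ by rw [e.orderOf_eq]

theorem orderOf_multiplicative_of_charP {K : Type*} [Field K] (q : ℕ) [Fact q.Prime] [CharP K q]
    {x : Multiplicative K} (hx : x ≠ 1) : orderOf x = q := by
  refine orderOf_eq_prime ?_ hx
  apply Multiplicative.toAdd.injective
  rw [toAdd_pow, nsmul_eq_mul, CharP.cast_eq_zero, zero_mul, toAdd_one]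

theorem half_le_avgOrder_multiplicative {K : Type*} [Field K] [Finite K] (q : ℕ) [Fact q.Prime]
    [CharP K q] : (q : ℝ) / 2 ≤ avgOrder (Multiplicative K) := by
  classical
  have := Fintype.ofFinite K
  have hcard : (2 : ℝ) ≤ Fintype.card K := by
    exact_mod_cast Fintype.one_lt_card (α := K)
  unfold avgOrder
  rw [finsum_eq_sum_of_fintype, Nat.card_eq_fintype_card, Fintype.card_multiplicative,
    le_div_iff₀ (by linarith)]
  have h : ∑ x ∈ (Finset.univ : Finset (Multiplicative K)).erase 1, (q : ℝ)
      ≤ ∑ x : Multiplicative K, (orderOf x : ℝ) := by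
    refine le_trans (Finset.sum_le_sum fun x hx ↦ ?_)
      (Finset.sum_le_sum_of_subset_of_nonneg (Finset.erase_subset _ _) fun _ _ _ ↦ by positivity)
    rw [orderOf_multiplicative_of_charP q (Finset.ne_of_mem_erase hx)]
  rw [Finset.sum_const, Finset.card_erase_of_mem (Finset.mem_univ _), Finset.card_univ,
    Fintype.card_multiplicative, nsmul_eq_mul, Nat.cast_sub Fintype.card_pos] at h
  refine le_trans ?_ h
  push_cast
  nlinarith [(Nat.cast_nonneg q : (0 : ℝ) ≤ q)]

theorem avgOrder_semidirectProduct_le {K : Type*} [Field K] [Finite K] (q : ℕ) [Fact q.Prime]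
    [CharP K q] (H : Subgroup Kˣ) [Fintype H] :
    avgOrder (Multiplicative K ⋊[H.mulAutOfUnits] H)
      ≤ ((q : ℝ) + (∑ h : H, orderOf h : ℕ)) / Nat.card H := by
  classical
  have := Fintype.ofFinite K
  have hle : ∀ g : Multiplicative K ⋊[H.mulAutOfUnits] H,
      (orderOf g : ℝ) ≤ (if g.right = 1 then (q : ℝ) else 0) + orderOf g.right := by
    intro g
    by_cases hg : g.right = 1
    · have h1 : g = SemidirectProduct.inl g.left := SemidirectProduct.ext rfl hg
      have h2 : orderOf g ≤ q := by
        rw [h1, orderOf_injective _ SemidirectProduct.inl_injective]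
        by_cases hx : g.left = 1
        · rw [hx, orderOf_one]
          exact (Fact.out : q.Prime).one_le
        · exact (orderOf_multiplicative_of_charP q hx).le
      rw [if_pos hg]
      have h3 : (orderOf g : ℝ) ≤ q := by exact_mod_cast h2
      linarith [(Nat.cast_nonneg (orderOf g.right) : (0 : ℝ) ≤ _)]
    · rw [if_neg hg, zero_add, orderOf_eq_orderOf_right H g hg]
  have hK : (0 : ℝ) < Nat.card (Multiplicative K) := by exact_mod_cast Nat.card_pos
  have hH : (0 : ℝ) < Nat.card H := by exact_mod_cast Nat.card_pos
  unfold avgOrder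
  rw [SemidirectProduct.card, finsum_eq_of_bijective (SemidirectProduct.equivProd)
    (g := fun a ↦ (orderOf (SemidirectProduct.equivProd.symm a) : ℝ))
    (Equiv.bijective _) (fun g ↦ by rw [Equiv.symm_apply_apply]), finsum_eq_sum_of_fintype,
    Nat.cast_mul,
    div_le_div_iff₀ (by positivity) hH]
  have hsum := Finset.sum_le_sum (s := Finset.univ)
    fun a _ ↦ hle (SemidirectProduct.equivProd.symm a)
  have hval : ∑ a : Multiplicative K × H,
      ((if (SemidirectProduct.equivProd (φ := H.mulAutOfUnits).symm a).right = 1 then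
          (q : ℝ) else 0)
        + orderOf (SemidirectProduct.equivProd (φ := H.mulAutOfUnits).symm a).right)
      = Nat.card (Multiplicative K) * ((q : ℝ) + (∑ h : H, orderOf h : ℕ)) := by
    rw [Fintype.sum_prod_type]
    simp [SemidirectProduct.equivProd, Finset.sum_add_distrib, mul_add]
  rw [hval] at hsum
  nlinarith

/-- If `n` is coprime to the prime `q`, some finite field of characteristic `q` has a unit of
order `n`. -/
theorem exists_orderOf_unit_galoisField (q n : ℕ) [Fact q.Prime] (hqn : q.Coprime n)
    (hn : 0 < n) : ∃ (d : ℕ) (u : (GaloisField q d)ˣ), orderOf u = n := by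
  have hd : n.totient ≠ 0 := (Nat.totient_pos.2 hn).ne'
  have hcard : Nat.card (GaloisField q n.totient)ˣ = q ^ n.totient - 1 := by
    rw [Nat.card_units, GaloisField.card q _ hd]
  have hdvd : n ∣ Nat.card (GaloisField q n.totient)ˣ := by
    rw [hcard]
    exact (Nat.modEq_iff_dvd' (Nat.one_le_pow _ _ (Fact.out : q.Prime).pos)).1
      (Nat.ModEq.pow_totient hqn).symm
  obtain ⟨g, hg⟩ := IsCyclic.exists_ofOrder_eq_natCard (α := (GaloisField q n.totient)ˣ)
  obtain ⟨m, hm⟩ := hdvd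
  have hpos : 0 < Nat.card (GaloisField q n.totient)ˣ := Nat.card_pos
  have hm0 : m ≠ 0 := by
    rintro rfl
    simp [hm] at hpos
  refine ⟨n.totient, g ^ m, ?_⟩
  rw [orderOf_pow_of_dvd hm0 (by rw [hg, hm]; exact dvd_mul_left _ _), hg, hm,
    Nat.mul_div_cancel _ (Nat.pos_of_ne_zero hm0)]

/-- For every real `c₂ > 0` there exist a finite group `G` and a normal subgroup
`N` of `G` such that `o(G) < c₂ · o(N)^(1/2)`. In particular there is no constant
`c₂ > 0` with `o(G) ≥ c₂ · o(N)^(1/2)` for all finite groups `G` and normal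
subgroups `N ⊴ G`. -/
theorem exists_avgOrder_lt_mul_normal_sqrt (c₂ : ℝ) (hc₂ : 0 < c₂) :
    ∃ (G : Type) (_ : Group G) (_ : Finite G) (N : Subgroup G), N.Normal ∧
      avgOrder G < c₂ * avgOrder N ^ ((1 : ℝ) / 2) := by
  obtain ⟨n, hn, hlt⟩ := exists_sum_divisors_mul_totient_lt (c₂ ^ 2 / 18) (by positivity)
  set T := ∑ d ∈ n.divisors, d * d.totient
  have hnT : n ≤ T := by
    refine le_trans ?_ (Finset.single_le_sum (f := fun d ↦ d * d.totient)
      (fun _ _ ↦ Nat.zero_le _) (Nat.mem_divisors_self n hn.ne'))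
    exact Nat.le_mul_of_pos_right _ (Nat.totient_pos.2 hn)
  obtain ⟨q, hq, hTq, hqT⟩ := Nat.exists_prime_lt_and_le_two_mul T (by lia)
  have : Fact q.Prime := ⟨hq⟩
  have hqn : q.Coprime n :=
    hq.coprime_iff_not_dvd.2 fun h ↦ by have := Nat.le_of_dvd hn h; lia
  obtain ⟨d, u, hu⟩ := exists_orderOf_unit_galoisField q n hqn hn
  set H := Subgroup.zpowers u
  have := Fintype.ofFinite H
  have hHn : Nat.card H = n := by rw [Nat.card_zpowers, hu]
  have hsum : ∑ h : H, orderOf h = T := by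
    rw [IsCyclic.sum_orderOf, ← Nat.card_eq_fintype_card, hHn]
  refine ⟨Multiplicative (GaloisField q d) ⋊[H.mulAutOfUnits] H, inferInstance,
    Finite.of_equiv _ SemidirectProduct.equivProd.symm, SemidirectProduct.inl.range, ?_, ?_⟩
  · rw [SemidirectProduct.range_inl_eq_ker_rightHom]
    infer_instance
  rw [← avgOrder_congr (MonoidHom.ofInjective SemidirectProduct.inl_injective), ← Real.sqrt_eq_rpow]
  have hG := avgOrder_semidirectProduct_le q H
  have hN := half_le_avgOrder_multiplicative (K := GaloisField q d) q
  rw [hsum, hHn] at hG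
  have hn' : (0 : ℝ) < n := by exact_mod_cast hn
  have hT' : (0 : ℝ) < T := by exact_mod_cast lt_of_lt_of_le hn hnT
  have hTq' : (T : ℝ) < q := by exact_mod_cast hTq
  have hqT' : (q : ℝ) ≤ 2 * T := by exact_mod_cast hqT
  calc avgOrder (Multiplicative (GaloisField q d) ⋊[H.mulAutOfUnits] H)
      ≤ 3 * T / n := hG.trans (by gcongr; linarith)
    _ < c₂ * √(T / 2) := by
        rw [div_lt_iff₀ hn']
        refine lt_of_pow_lt_pow_left₀ 2 (by positivity) ?_
        rw [mul_pow, mul_pow, mul_pow, Real.sq_sqrt (by positivity)]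
        nlinarith [mul_lt_mul_of_pos_left hlt hT']
    _ ≤ c₂ * √(avgOrder (Multiplicative (GaloisField q d))) := by
        gcongr
        linarith
end
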